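/- Let P(a,b,z) = z³ − (4 + 2cos(a−b))z − 2cos a − 2cos b. At each of the four points (π/3, 5π/3, −1), (5π/3, π/3, −1), (2π/3, 4π/3, 1), (4π/3, 2π/3, 1), the 3×3 Hessian matrix of P (in the variables a,b,z) is nondegenerate; at the two points with z = −1 its determinant is −24 and it has exactly two positive and one negative eigenvalue (signature (+,+,−)), while at the two points with z = 1 its determinant is 24 and it has exactly two negative and one positive eigenvalue (signature (−,−,+)). Hence all four points are Dirac points. -/

import Mathlib

open Real Polynomial Matrix

/-- The characteristic polynomial of the triangle-graph Harper Hamiltonian with one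
double bond, as a smooth real function of `(a, b, z)`. -/
noncomputable def P (a b z : ℝ) : ℝ :=
  z ^ 3 - (4 + 2 * Real.cos (a - b)) * z - 2 * Real.cos a - 2 * Real.cos b

/-- Partial derivative in the first variable. -/
noncomputable def pda (f : ℝ → ℝ → ℝ → ℝ) (a b z : ℝ) : ℝ :=
  deriv (fun t => f t b z) a

/-- Partial derivative in the second variable. -/
noncomputable def pdb (f : ℝ → ℝ → ℝ → ℝ) (a b z : ℝ) : ℝ :=
  deriv (fun t => f a t z) b

/-- Partial derivative in the third variable. -/
noncomputable def pdz (f : ℝ → ℝ → ℝ → ℝ) (a b z : ℝ) : ℝ :=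
  deriv (fun t => f a b t) z

/-- The Hessian matrix of `P` in the variables `(a, b, z)`, in this order. -/
noncomputable def hessP (a b z : ℝ) : Matrix (Fin 3) (Fin 3) ℝ :=
  !![pda (pda P) a b z, pdb (pda P) a b z, pdz (pda P) a b z;
     pda (pdb P) a b z, pdb (pdb P) a b z, pdz (pdb P) a b z;
     pda (pdz P) a b z, pdb (pdz P) a b z, pdz (pdz P) a b z]

theorem hasDerivAt_cos_sub_const (a b : ℝ) :
    HasDerivAt (fun t => Real.cos (t - b)) (-Real.sin (a - b)) a := by
  simpa using ((hasDerivAt_id a).sub_const b).cos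

theorem hasDerivAt_cos_const_sub (a b : ℝ) :
    HasDerivAt (fun t => Real.cos (a - t)) (Real.sin (a - b)) b := by
  simpa using ((hasDerivAt_id b).const_sub a).cos

theorem hasDerivAt_sin_sub_const (a b : ℝ) :
    HasDerivAt (fun t => Real.sin (t - b)) (Real.cos (a - b)) a := by
  simpa using ((hasDerivAt_id a).sub_const b).sin

theorem hasDerivAt_sin_const_sub (a b : ℝ) :
    HasDerivAt (fun t => Real.sin (a - t)) (-Real.cos (a - b)) b := by
  simpa using ((hasDerivAt_id b).const_sub a).sin

theorem pda_P : pda P = fun a b z => 2 * Real.sin (a - b) * z + 2 * Real.sin a := by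
  funext a b z
  refine (HasDerivAt.congr_deriv (((((((hasDerivAt_cos_sub_const a b).const_mul 2).const_add
    4).mul_const z).const_sub (z ^ 3)).sub ((Real.hasDerivAt_cos a).const_mul 2)).sub_const
    (2 * Real.cos b)) ?_).deriv
  ring

theorem pdb_P : pdb P = fun a b z => -(2 * Real.sin (a - b) * z) + 2 * Real.sin b := by
  funext a b z
  refine (HasDerivAt.congr_deriv (((((((hasDerivAt_cos_const_sub a b).const_mul 2).const_add
    4).mul_const z).const_sub (z ^ 3)).sub_const (2 * Real.cos a)).sub
    ((Real.hasDerivAt_cos b).const_mul 2)) ?_).deriv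
  ring

theorem pdz_P : pdz P = fun a b z => 3 * z ^ 2 - (4 + 2 * Real.cos (a - b)) := by
  funext a b z
  refine (HasDerivAt.congr_deriv ((((hasDerivAt_pow 3 z).sub ((hasDerivAt_id z).const_mul
    (4 + 2 * Real.cos (a - b)))).sub_const (2 * Real.cos a)).sub_const (2 * Real.cos b)) ?_).deriv
  norm_num

theorem hessP_eq (a b z : ℝ) :
    hessP a b z =
      !![2 * Real.cos (a - b) * z + 2 * Real.cos a, -(2 * Real.cos (a - b) * z),
          2 * Real.sin (a - b);
        -(2 * Real.cos (a - b) * z), 2 * Real.cos (a - b) * z + 2 * Real.cos b,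
          -(2 * Real.sin (a - b));
        2 * Real.sin (a - b), -(2 * Real.sin (a - b)), 6 * z] := by
  have haa : pda (pda P) a b z = 2 * Real.cos (a - b) * z + 2 * Real.cos a := by
    rw [pda_P]
    exact ((((hasDerivAt_sin_sub_const a b).const_mul 2).mul_const z).add
      ((Real.hasDerivAt_sin a).const_mul 2)).deriv
  have hba : pdb (pda P) a b z = -(2 * Real.cos (a - b) * z) := by
    rw [pda_P]
    refine (HasDerivAt.congr_deriv ((((hasDerivAt_sin_const_sub a b).const_mul 2).mul_const
      z).add_const (2 * Real.sin a)) ?_).deriv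
    ring
  have hza : pdz (pda P) a b z = 2 * Real.sin (a - b) := by
    rw [pda_P]
    refine (HasDerivAt.congr_deriv (((hasDerivAt_id z).const_mul
      (2 * Real.sin (a - b))).add_const (2 * Real.sin a)) ?_).deriv
    ring
  have hab : pda (pdb P) a b z = -(2 * Real.cos (a - b) * z) := by
    rw [pdb_P]
    exact ((((hasDerivAt_sin_sub_const a b).const_mul 2).mul_const z).neg.add_const
      (2 * Real.sin b)).deriv
  have hbb : pdb (pdb P) a b z = 2 * Real.cos (a - b) * z + 2 * Real.cos b := by
    rw [pdb_P]
    refine (HasDerivAt.congr_deriv ((((hasDerivAt_sin_const_sub a b).const_mul 2).mul_const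
      z).neg.add ((Real.hasDerivAt_sin b).const_mul 2)) ?_).deriv
    ring
  have hzb : pdz (pdb P) a b z = -(2 * Real.sin (a - b)) := by
    rw [pdb_P]
    refine (HasDerivAt.congr_deriv (((hasDerivAt_id z).const_mul
      (2 * Real.sin (a - b))).neg.add_const (2 * Real.sin b)) ?_).deriv
    ring
  have haz : pda (pdz P) a b z = 2 * Real.sin (a - b) := by
    rw [pdz_P]
    refine (HasDerivAt.congr_deriv ((((hasDerivAt_cos_sub_const a b).const_mul 2).const_add
      4).const_sub (3 * z ^ 2)) ?_).deriv
    ring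
  have hbz : pdb (pdz P) a b z = -(2 * Real.sin (a - b)) := by
    rw [pdz_P]
    exact ((((hasDerivAt_cos_const_sub a b).const_mul 2).const_add 4).const_sub (3 * z ^ 2)).deriv
  have hzz : pdz (pdz P) a b z = 6 * z := by
    rw [pdz_P]
    refine (HasDerivAt.congr_deriv (((hasDerivAt_pow 2 z).const_mul 3).sub_const
      (4 + 2 * Real.cos (a - b))) ?_).deriv
    norm_num
    ring
  rw [hessP, haa, hba, hza, hab, hbb, hzb, haz, hbz, hzz]

/-- Determinant and factored characteristic polynomial of the Hessian at a point with `z = ±1`,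
`cos a = cos b = -z / 2` and `cos (a - b) = -1 / 2`. -/
theorem det_and_charpoly_hessP {a b z : ℝ} (hz : z ^ 2 = 1) (ha : 2 * Real.cos a = -z)
    (hb : 2 * Real.cos b = -z) (hab : 2 * Real.cos (a - b) = -1) :
    (hessP a b z).det = 24 * z ∧
      (hessP a b z).charpoly = (X - C (-z)) * (X - C (z * ((3 - √105) / 2))) *
        (X - C (z * ((3 + √105) / 2))) := by
  obtain ⟨s, hs⟩ : ∃ s, s = 2 * Real.sin (a - b) := ⟨_, rfl⟩
  have hs2 : s ^ 2 = 3 := by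
    have h := Real.sin_sq_add_cos_sq (a - b)
    rw [hs]
    linear_combination 4 * h - (2 * Real.cos (a - b) - 1) * hab
  have hr : √105 ^ 2 = 105 := Real.sq_sqrt (by norm_num)
  rw [hessP_eq, ha, hb, hab, ← hs]
  constructor
  · rw [det_fin_three]
    simp
    linear_combination (2 * z) * hs2 + 18 * z * hz
  · refine Polynomial.funext fun x => ?_
    rw [Matrix.eval_charpoly, det_fin_three]
    simp [Matrix.scalar_apply]
    linear_combination (-(2 * x + 2 * z)) * hs2 + (6 * x + 6 * z) * hz +
      (x * z ^ 2 + z ^ 3) / 4 * hr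

theorem doubled_triangle_dirac_points :
    (∀ p : ℝ × ℝ × ℝ,
        p ∈ ({(π / 3, 5 * π / 3, (-1 : ℝ)), (5 * π / 3, π / 3, (-1 : ℝ))} : Set (ℝ × ℝ × ℝ)) →
        (hessP p.1 p.2.1 p.2.2).det = -24 ∧
        ∃ l1 l2 l3 : ℝ, (hessP p.1 p.2.1 p.2.2).charpoly =
            (X - C l1) * (X - C l2) * (X - C l3) ∧ 0 < l1 ∧ 0 < l2 ∧ l3 < 0) ∧
    (∀ p : ℝ × ℝ × ℝ,
        p ∈ ({(2 * π / 3, 4 * π / 3, (1 : ℝ)), (4 * π / 3, 2 * π / 3, (1 : ℝ))} : Set (ℝ × ℝ × ℝ)) →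
        (hessP p.1 p.2.1 p.2.2).det = 24 ∧
        ∃ l1 l2 l3 : ℝ, (hessP p.1 p.2.1 p.2.2).charpoly =
            (X - C l1) * (X - C l2) * (X - C l3) ∧ l1 < 0 ∧ l2 < 0 ∧ 0 < l3) := by
  have hcos₁ : Real.cos (π / 3) = 1 / 2 := Real.cos_pi_div_three
  have hcos₂ : Real.cos (2 * π / 3) = -(1 / 2) := by
    rw [show 2 * π / 3 = π - π / 3 by ring, Real.cos_pi_sub, hcos₁]
  have hcos₄ : Real.cos (4 * π / 3) = -(1 / 2) := by
    rw [show 4 * π / 3 = π / 3 + π by ring, Real.cos_add_pi, hcos₁]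
  have hcos₅ : Real.cos (5 * π / 3) = 1 / 2 := by
    rw [show 5 * π / 3 = 2 * π - π / 3 by ring, Real.cos_two_pi_sub, hcos₁]
  have hr : 3 < √105 := Real.lt_sqrt_of_sq_lt (by norm_num)
  have hcos₄' : Real.cos (π / 3 - 5 * π / 3) = -(1 / 2) := by
    rw [show π / 3 - 5 * π / 3 = -(4 * π / 3) by ring, Real.cos_neg, hcos₄]
  have hcos₂' : Real.cos (2 * π / 3 - 4 * π / 3) = -(1 / 2) := by
    rw [show 2 * π / 3 - 4 * π / 3 = -(2 * π / 3) by ring, Real.cos_neg, hcos₂]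
  constructor
  · rintro ⟨a, b, z⟩ hp
    obtain ⟨ha, hb, hab, rfl⟩ : Real.cos a = 1 / 2 ∧ Real.cos b = 1 / 2 ∧
        Real.cos (a - b) = -(1 / 2) ∧ z = -1 := by
      simp only [Set.mem_insert_iff, Set.mem_singleton_iff, Prod.mk.injEq] at hp
      rcases hp with ⟨rfl, rfl, rfl⟩ | ⟨rfl, rfl, rfl⟩
      · exact ⟨hcos₁, hcos₅, hcos₄', rfl⟩
      · exact ⟨hcos₅, hcos₁, by rw [← Real.cos_neg, neg_sub, hcos₄'], rfl⟩
    obtain ⟨hdet, hchar⟩ := det_and_charpoly_hessP (a := a) (b := b) (z := -1) (by norm_num)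
      (by linarith) (by linarith) (by linarith)
    exact ⟨by rw [hdet]; norm_num, _, _, _, hchar, by norm_num, by linarith, by linarith⟩
  · rintro ⟨a, b, z⟩ hp
    obtain ⟨ha, hb, hab, rfl⟩ : Real.cos a = -(1 / 2) ∧ Real.cos b = -(1 / 2) ∧
        Real.cos (a - b) = -(1 / 2) ∧ z = 1 := by
      simp only [Set.mem_insert_iff, Set.mem_singleton_iff, Prod.mk.injEq] at hp
      rcases hp with ⟨rfl, rfl, rfl⟩ | ⟨rfl, rfl, rfl⟩
      · exact ⟨hcos₂, hcos₄, hcos₂', rfl⟩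
      · exact ⟨hcos₄, hcos₂, by rw [← Real.cos_neg, neg_sub, hcos₂'], rfl⟩
    obtain ⟨hdet, hchar⟩ := det_and_charpoly_hessP (a := a) (b := b) (z := 1) (by norm_num)
      (by linarith) (by linarith) (by linarith)
    exact ⟨by rw [hdet]; norm_num, _, _, _, hchar, by norm_num, by linarith, by linarith⟩
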